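/- (Poisson summation for monic polynomials) Let q be prime, f ∈ F_q[t] of degree n, m a positive integer, and F a function periodic modulo f with Fourier transform F̂(u;f) = Σ_{V mod f} F(V) e(uV/f). Then Σ_{g monic, deg g = m} F(g) = (q^m/|f|) Σ_{deg V ≤ n−m−1} F̂(V;f) e(−V x^m/f), where x = t and the sum includes V = 0 (with deg 0 = −∞). -/

import Mathlib

open Polynomial

/-- The polynomial `∑ c i * X^i`, encoding "a residue of degree < n". -/
noncomputable def res {F : Type} [Field F] {n : ℕ} (c : Fin n → F) : Polynomial F :=
  ∑ i : Fin n, Polynomial.C (c i) * Polynomial.X ^ (i : ℕ)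

/-- The element `t` of `F_q((1/t))`, realized as the inverse of the variable of
`LaurentSeries (ZMod q)` (whose variable plays the role of `1/t`). -/
noncomputable def tvar (q : ℕ) [Fact (Nat.Prime q)] : LaurentSeries (ZMod q) :=
  (HahnSeries.single (1 : ℤ) (1 : ZMod q))⁻¹

/-- The embedding of `F_q[t]` into `F_q((1/t))`. -/
noncomputable def polyToLS (q : ℕ) [Fact (Nat.Prime q)] (A : Polynomial (ZMod q)) :
    LaurentSeries (ZMod q) :=
  Polynomial.eval₂ (algebraMap (ZMod q) (LaurentSeries (ZMod q))) (tvar q) A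

/-- Hayes' additive character: `e(a) = exp(2πi a₁ / q)` where `a₁` is the coefficient
of `1/t` in the Laurent expansion of `a`. -/
noncomputable def eChar (q : ℕ) [Fact (Nat.Prime q)] (a : LaurentSeries (ZMod q)) : ℂ :=
  Complex.exp (2 * Real.pi * Complex.I * (((a.coeff 1).val : ℂ)) / q)

theorem res_coeff {F : Type} [Field F] {n : ℕ} (c : Fin n → F) (k : ℕ) :
    (res c).coeff k = if h : k < n then c ⟨k, h⟩ else 0 := by
  unfold res
  rw [Polynomial.finsetSum_coeff]
  simp only [Polynomial.coeff_C_mul, Polynomial.coeff_X_pow]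
  split_ifs with h
  · rw [Finset.sum_eq_single ⟨k, h⟩]
    · simp
    · intro b _ hb
      have : k ≠ (b : ℕ) := fun e => hb (Fin.ext e.symm)
      simp [this]
    · simp
  · apply Finset.sum_eq_zero
    intro b _
    have : k ≠ (b : ℕ) := by have := b.2; omega
    simp [this]

theorem res_add {F : Type} [Field F] {n : ℕ} (c d : Fin n → F) :
    res (c + d) = res c + res d := by
  ext k
  rw [Polynomial.coeff_add, res_coeff, res_coeff, res_coeff]
  split_ifs <;> simp

theorem res_of_degree {F : Type} [Field F] {n : ℕ} (A : Polynomial F)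
    (h : ∀ k, n ≤ k → A.coeff k = 0) : res (fun i : Fin n => A.coeff i) = A := by
  ext k
  rw [res_coeff]
  split_ifs with hk
  · rfl
  · exact (h k (by omega)).symm

theorem polyToLS_eq_sum (q : ℕ) [Fact (Nat.Prime q)] (A : Polynomial (ZMod q)) :
    polyToLS q A = ∑ i ∈ Finset.range (A.natDegree + 1),
      HahnSeries.single (-(i : ℤ)) (A.coeff i) := by
  unfold polyToLS tvar
  rw [Polynomial.eval₂_eq_sum_range]
  apply Finset.sum_congr rfl
  intro i _
  rw [HahnSeries.inv_single, HahnSeries.single_pow, LaurentSeries.algebraMap_apply,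
    HahnSeries.C_apply, HahnSeries.single_mul_single]
  simp

theorem polyToLS_coeff (q : ℕ) [Fact (Nat.Prime q)] (A : Polynomial (ZMod q)) (i : ℕ) :
    (polyToLS q A).coeff (-(i : ℤ)) = A.coeff i := by
  rw [polyToLS_eq_sum, HahnSeries.coeff_sum]
  by_cases h : i ∈ Finset.range (A.natDegree + 1)
  · rw [Finset.sum_eq_single_of_mem i h]
    · simp
    · intro b _ hb
      apply HahnSeries.coeff_single_of_ne
      omega
  · rw [Finset.sum_eq_zero]
    · symm
      apply Polynomial.coeff_eq_zero_of_natDegree_lt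
      simpa using h
    · intro b hb
      apply HahnSeries.coeff_single_of_ne
      rintro e
      have : i = b := by omega
      exact h (this ▸ hb)

theorem polyToLS_coeff_lt (q : ℕ) [Fact (Nat.Prime q)] (A : Polynomial (ZMod q)) (k : ℤ)
    (hk : k < -(A.natDegree : ℤ)) : (polyToLS q A).coeff k = 0 := by
  rw [polyToLS_eq_sum, HahnSeries.coeff_sum, Finset.sum_eq_zero]
  intro b hb
  apply HahnSeries.coeff_single_of_ne
  have := Finset.mem_range.1 hb
  omega

theorem polyToLS_ne_zero (q : ℕ) [Fact (Nat.Prime q)] (A : Polynomial (ZMod q)) (hA : A ≠ 0) :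
    polyToLS q A ≠ 0 := by
  intro h
  have h1 := polyToLS_coeff q A A.natDegree
  rw [h] at h1
  exact hA (Polynomial.leadingCoeff_eq_zero.1 h1.symm)

theorem polyToLS_order (q : ℕ) [Fact (Nat.Prime q)] (A : Polynomial (ZMod q)) (hA : A ≠ 0) :
    (polyToLS q A).order = -(A.natDegree : ℤ) := by
  apply le_antisymm
  · apply HahnSeries.order_le_of_coeff_ne_zero
    rw [polyToLS_coeff]
    exact fun h => hA (Polynomial.leadingCoeff_eq_zero.1 h)
  · by_contra! h
    have h1 := polyToLS_coeff_lt q A _ h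
    exact polyToLS_ne_zero q A hA (HahnSeries.coeff_order_eq_zero.1 h1)

theorem polyToLS_div_order (q : ℕ) [Fact (Nat.Prime q)] (A f : Polynomial (ZMod q))
    (hA : A ≠ 0) (hf : f ≠ 0) :
    (polyToLS q A / polyToLS q f).order = (f.natDegree : ℤ) - A.natDegree := by
  have h0 : polyToLS q A / polyToLS q f ≠ 0 :=
    div_ne_zero (polyToLS_ne_zero q A hA) (polyToLS_ne_zero q f hf)
  have h1 := HahnSeries.order_mul h0 (polyToLS_ne_zero q f hf)
  rw [div_mul_cancel₀ _ (polyToLS_ne_zero q f hf), polyToLS_order q A hA,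
    polyToLS_order q f hf] at h1
  omega

theorem eChar_eq (q : ℕ) [Fact (Nat.Prime q)] (a : LaurentSeries (ZMod q)) :
    eChar q a = ZMod.stdAddChar (a.coeff 1) := by
  rw [ZMod.stdAddChar_apply, ZMod.toCircle_apply, eChar]

theorem polyToLS_add (q : ℕ) [Fact (Nat.Prime q)] (A B : Polynomial (ZMod q)) :
    polyToLS q (A + B) = polyToLS q A + polyToLS q B := by
  simp [polyToLS, Polynomial.eval₂_add]

theorem eChar_poly_add (q : ℕ) [Fact (Nat.Prime q)] (f A B : Polynomial (ZMod q)) :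
    eChar q (polyToLS q (A + B) / polyToLS q f) =
      eChar q (polyToLS q A / polyToLS q f) * eChar q (polyToLS q B / polyToLS q f) := by
  rw [eChar_eq, eChar_eq, eChar_eq, ← AddChar.map_add_eq_mul, polyToLS_add, add_div,
    HahnSeries.coeff_add]

theorem eChar_poly_zero (q : ℕ) [Fact (Nat.Prime q)] (f : Polynomial (ZMod q)) :
    eChar q (polyToLS q 0 / polyToLS q f) = 1 := by
  simp [eChar_eq, polyToLS]

theorem eChar_poly_small (q : ℕ) [Fact (Nat.Prime q)] (f A : Polynomial (ZMod q)) (hf : f ≠ 0)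
    (h : A.natDegree + 1 < f.natDegree) :
    eChar q (polyToLS q A / polyToLS q f) = 1 := by
  by_cases hA : A = 0
  · rw [hA, eChar_poly_zero]
  · rw [eChar_eq, HahnSeries.coeff_eq_zero_of_lt_order, AddChar.map_zero_eq_one]
    rw [polyToLS_div_order q A f hA hf]
    omega

theorem eChar_poly_ne_one (q : ℕ) [Fact (Nat.Prime q)] (f A : Polynomial (ZMod q)) (hf : f ≠ 0)
    (hA : A ≠ 0) (h : A.natDegree + 1 = f.natDegree) :
    eChar q (polyToLS q A / polyToLS q f) ≠ 1 := by
  have ho := polyToLS_div_order q A f hA hf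
  have ho1 : (polyToLS q A / polyToLS q f).order = 1 := by omega
  rw [eChar_eq, ← ho1]
  intro h1
  rw [← AddChar.map_zero_eq_one (ZMod.stdAddChar (N := q))] at h1
  have h2 := ZMod.injective_stdAddChar h1
  exact div_ne_zero (polyToLS_ne_zero q A hA) (polyToLS_ne_zero q f hf)
    (HahnSeries.coeff_order_eq_zero.1 h2)

/-- Orthogonality, small case. -/
theorem orth_small (q : ℕ) [Fact (Nat.Prime q)] (f B : Polynomial (ZMod q)) (hf : f ≠ 0)
    (m : ℕ) (hm : m < f.natDegree) (h0 : 0 < m) (hB : ∀ k, m ≤ k → B.coeff k = 0) :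
    ∑ v : Fin (f.natDegree - m) → ZMod q, eChar q (polyToLS q (res v * B) / polyToLS q f)
      = (q : ℂ) ^ (f.natDegree - m) := by
  rw [Finset.sum_congr rfl (g := fun _ => (1 : ℂ))]
  · simp
  · intro v _
    apply eChar_poly_small q f _ hf
    have h1 : (res v).natDegree ≤ f.natDegree - m - 1 := by
      rw [Polynomial.natDegree_le_iff_coeff_eq_zero]
      intro N hN
      rw [res_coeff, dif_neg (by omega)]
    have h2 : B.natDegree ≤ m - 1 := by
      rw [Polynomial.natDegree_le_iff_coeff_eq_zero]
      intro N hN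
      exact hB N (by omega)
    have := Polynomial.natDegree_mul_le (p := res v) (q := B)
    omega

/-- Orthogonality, large case. -/
theorem orth_large (q : ℕ) [Fact (Nat.Prime q)] (f B : Polynomial (ZMod q)) (hf : f ≠ 0)
    (m : ℕ) (hB : m ≤ B.natDegree) (hB0 : B ≠ 0) (hBn : B.natDegree < f.natDegree) :
    ∑ v : Fin (f.natDegree - m) → ZMod q, eChar q (polyToLS q (res v * B) / polyToLS q f)
      = 0 := by
  obtain ⟨w, hw⟩ : ∃ w : Fin (f.natDegree - m) → ZMod q,
      res w = X ^ (f.natDegree - 1 - B.natDegree) :=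
    ⟨_, res_of_degree _ (by
      intro k hk
      rw [Polynomial.coeff_X_pow, if_neg (by omega)])⟩
  have hne : eChar q (polyToLS q (res w * B) / polyToLS q f) ≠ 1 := by
    apply eChar_poly_ne_one q f _ hf
    · rw [hw]
      exact mul_ne_zero (pow_ne_zero _ X_ne_zero) hB0
    · rw [hw, Polynomial.natDegree_mul (pow_ne_zero _ X_ne_zero) hB0, natDegree_X_pow]
      omega
  have hs : ∑ v : Fin (f.natDegree - m) → ZMod q,
        eChar q (polyToLS q (res (w + v) * B) / polyToLS q f) =
      ∑ v : Fin (f.natDegree - m) → ZMod q, eChar q (polyToLS q (res v * B) / polyToLS q f) :=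
    Equiv.sum_comp (Equiv.addLeft w)
      (fun v => eChar q (polyToLS q (res v * B) / polyToLS q f))
  simp only [res_add, add_mul, eChar_poly_add] at hs
  rw [← Finset.mul_sum] at hs
  exact eq_zero_of_mul_eq_self_left hne hs

/-- Summing over a complete residue system is translation invariant. -/
theorem sum_shift (q : ℕ) [Fact (Nat.Prime q)] (f : Polynomial (ZMod q)) (hf : f ≠ 0)
    (F : Polynomial (ZMod q) → ℂ)
    (hper : ∀ A B : Polynomial (ZMod q), f ∣ (A - B) → F A = F B) (A : Polynomial (ZMod q)) :
    ∑ c : Fin f.natDegree → ZMod q, F (A + res c) =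
      ∑ c : Fin f.natDegree → ZMod q, F (res c) := by
  obtain ⟨a, ha⟩ : ∃ a : Fin f.natDegree → ZMod q, res a = A % f :=
    ⟨_, res_of_degree _ (by
      intro k hk
      apply Polynomial.coeff_eq_zero_of_degree_lt
      refine (EuclideanDomain.mod_lt A hf).trans_le ?_
      rw [Polynomial.degree_eq_natDegree hf]
      exact_mod_cast hk)⟩
  rw [← Equiv.sum_comp (Equiv.addLeft a) (fun c => F (res c))]
  apply Finset.sum_congr rfl
  intro c _
  apply hper
  rw [Equiv.coe_addLeft, res_add, ha]
  refine ⟨A / f, ?_⟩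
  have := EuclideanDomain.div_add_mod A f
  linear_combination -this


/-- Poisson summation for monic polynomials: for `F` periodic mod `f` (`deg f = n`) with
Fourier transform `F̂`, and `m ≥ 1`,
`Σ_{g monic, deg g = m} F(g) = (q^m/|f|) Σ_{deg V ≤ n-m-1} F̂(V; f) e(-V t^m / f)`.
Monic `g` of degree `m` are parametrized as `X^m + res c`, and `V` of degree `≤ n-m-1`
(including `V = 0`, of degree `-∞`) as `res c` with `c : Fin (n-m) → ZMod q`. -/
theorem poisson_summation_monic (q : ℕ) [Fact (Nat.Prime q)]
    (f : Polynomial (ZMod q)) (n m : ℕ) (hf : f ≠ 0) (hn : f.natDegree = n) (hm : 0 < m)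
    (F : Polynomial (ZMod q) → ℂ)
    (hper : ∀ A B : Polynomial (ZMod q), f ∣ (A - B) → F A = F B)
    (Fhat : Polynomial (ZMod q) → ℂ)
    (hFhat : ∀ u : Polynomial (ZMod q),
      Fhat u = ∑ c : Fin n → ZMod q,
        F (res c) * eChar q (polyToLS q (u * res c) / polyToLS q f)) :
    ∑ c : Fin m → ZMod q, F (Polynomial.X ^ m + res c)
      = ((q : ℂ) ^ m / (q : ℂ) ^ n) *
        ∑ c : Fin (n - m) → ZMod q,
          Fhat (res c) *
            eChar q (polyToLS q (-(res c) * Polynomial.X ^ m) / polyToLS q f) := by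
  subst hn
  have hq : (q : ℂ) ≠ 0 := Nat.cast_ne_zero.2 (Fact.out : Nat.Prime q).ne_zero
  rcases Nat.lt_or_ge m f.natDegree with hlt | hge
  · -- the main case `m < n`
    have key : ∀ v : Fin (f.natDegree - m) → ZMod q,
        Fhat (res v) * eChar q (polyToLS q (-(res v) * Polynomial.X ^ m) / polyToLS q f) =
        ∑ b : Fin f.natDegree → ZMod q, F (X ^ m + res b) *
          eChar q (polyToLS q (res v * res b) / polyToLS q f) := by
      intro v
      obtain ⟨x, hx⟩ : ∃ x : Fin f.natDegree → ZMod q, res x = X ^ m :=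
        ⟨_, res_of_degree _ (by
          intro k hk
          rw [Polynomial.coeff_X_pow, if_neg (by omega)])⟩
      rw [hFhat, ← Equiv.sum_comp (Equiv.addLeft x), Finset.sum_mul]
      apply Finset.sum_congr rfl
      intro b _
      rw [Equiv.coe_addLeft, res_add, hx, mul_assoc, ← eChar_poly_add]
      congr 4
      ring
    rw [Finset.sum_congr rfl (fun v _ => key v), Finset.sum_comm]
    simp only [← Finset.mul_sum]
    rw [Finset.mul_sum]
    let pad : (Fin m → ZMod q) → (Fin f.natDegree → ZMod q) := fun c i => (res c).coeff i
    have hpad : ∀ c, res (pad c) = res c := fun c => res_of_degree _ (by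
      intro k hk
      rw [res_coeff, dif_neg (by omega)])
    apply Finset.sum_of_injOn pad
    · intro c _ d _ h
      have h1 : res c = res d := by rw [← hpad, ← hpad d, h]
      funext i
      have h2 := congrArg (fun p => p.coeff (i : ℕ)) h1
      simpa [res_coeff] using h2
    · intro _ _
      simp
    · intro b _ hb
      have hsmall : ¬ ∀ k, m ≤ k → (res b).coeff k = 0 := by
        intro h
        apply hb
        refine ⟨fun i => (res b).coeff i, by simp, ?_⟩
        funext i
        change (res _).coeff (i : ℕ) = _
        rw [res_of_degree _ h, res_coeff, dif_pos i.2]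
      push Not at hsmall
      obtain ⟨k, hk, hbk⟩ := hsmall
      rw [orth_large q f (res b) hf m]
      · simp
      · exact hk.trans (Polynomial.le_natDegree_of_ne_zero hbk)
      · rintro h
        simp [h] at hbk
      · have : (res b).natDegree ≤ f.natDegree - 1 := by
          rw [Polynomial.natDegree_le_iff_coeff_eq_zero]
          intro N hN
          rw [res_coeff, dif_neg (by omega)]
        omega
    · intro c _
      rw [hpad, orth_small q f (res c) hf m hlt hm]
      · have : (q : ℂ) ^ f.natDegree = q ^ m * q ^ (f.natDegree - m) := by
          rw [← pow_add]
          congr 1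
          omega
        rw [this]
        field_simp
      · intro k hk
        rw [res_coeff, dif_neg (by omega)]
  · -- the case `n ≤ m`
    have hz : f.natDegree - m = 0 := by omega
    have hr : ∀ v : Fin (f.natDegree - m) → ZMod q, res v = 0 := by
      intro v
      ext k
      rw [res_coeff, dif_neg (by omega), Polynomial.coeff_zero]
    have hcard : Fintype.card (Fin (f.natDegree - m) → ZMod q) = 1 := by
      simp [hz]
    simp only [hr, neg_zero, zero_mul, eChar_poly_zero, mul_one, hFhat, Finset.sum_const,
      Finset.card_univ, hcard, one_smul]
    have hshift : ∀ r : Fin f.natDegree → ZMod q,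
        ∑ c : Fin m → ZMod q, F (X ^ m + res c + res r) =
          ∑ c : Fin m → ZMod q, F (X ^ m + res c) := by
      intro r
      obtain ⟨x, hx⟩ : ∃ x : Fin m → ZMod q, res x = res r :=
        ⟨_, res_of_degree _ (by
          intro k hk
          rw [res_coeff, dif_neg (by omega)])⟩
      rw [← Equiv.sum_comp (Equiv.addRight x) (fun c => F (X ^ m + res c))]
      apply Finset.sum_congr rfl
      intro c _
      rw [Equiv.coe_addRight, res_add, hx, add_assoc]
    have h1 : ∑ r : Fin f.natDegree → ZMod q, ∑ c : Fin m → ZMod q, F (X ^ m + res c + res r) =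
        (q : ℂ) ^ f.natDegree * ∑ c : Fin m → ZMod q, F (X ^ m + res c) := by
      simp [hshift]
    rw [Finset.sum_comm] at h1
    simp only [sum_shift q f hf F hper] at h1
    rw [Finset.sum_const, Finset.card_univ] at h1
    simp only [Fintype.card_pi, ZMod.card, Finset.prod_const, Finset.card_univ, Fintype.card_fin,
      nsmul_eq_mul, Nat.cast_pow] at h1
    rw [div_mul_eq_mul_div, h1, mul_div_cancel_left₀ _ (pow_ne_zero _ hq)]
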